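/- arXiv:1905.12761 — 2 statements merged into one kernel-verified Lean document; each statement's English description precedes it below -/
import Mathlib

section
/- For every two-dimensional elasticity tensor C there exists a rotation R ∈ SO(2) such that the conjugated symmetry group { R Q Rᵀ : Q is a symmetry transformation of C } is equal, as a subset of O(2), to exactly one of the four standard symmetry groups: the oblique group, the rectangular group, the square group, or the isotropic group. Moreover, a tensor invariant under the rectangular group satisfies C₁₁₁₂ = C₂₂₁₂ = 0; one invariant under the square group additionally satisfies C₁₁₁₁ = C₂₂₂₂; and one invariant under the isotropic group additionally satisfies C₁₂₁₂ = (C₁₁₁₁ − C₁₁₂₂)/2. -/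
open Matrix Real

/-- Counterclockwise rotation by angle `θ`. -/
noncomputable def Rot (θ : ℝ) : Matrix (Fin 2) (Fin 2) ℝ :=
  !![Real.cos θ, -Real.sin θ; Real.sin θ, Real.cos θ]

/-- Reflection about the line through the origin making angle `θ` with the x-axis. -/
noncomputable def Ref (θ : ℝ) : Matrix (Fin 2) (Fin 2) ℝ :=
  !![Real.cos (2*θ), Real.sin (2*θ); Real.sin (2*θ), -Real.cos (2*θ)]

/-- A two-dimensional elasticity tensor: minor and major symmetries. -/
def IsElast2 (C : Fin 2 → Fin 2 → Fin 2 → Fin 2 → ℝ) : Prop :=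
  (∀ i j k l, C i j k l = C j i k l) ∧
  (∀ i j k l, C i j k l = C i j l k) ∧
  (∀ i j k l, C i j k l = C k l i j)

/-- `Q` is a symmetry transformation of the tensor `C`. -/
def IsSymTrans (C : Fin 2 → Fin 2 → Fin 2 → Fin 2 → ℝ)
    (Q : Matrix (Fin 2) (Fin 2) ℝ) : Prop :=
  ∀ i j k l, C i j k l =
    ∑ p, ∑ q, ∑ r, ∑ s, Q i p * Q j q * Q k r * Q l s * C p q r s

/-- The oblique symmetry group `{I, -I}`, as the subgroup of O(2) generated by `-I`. -/
noncomputable def obliqueGroup : Subgroup ↥(Matrix.orthogonalGroup (Fin 2) ℝ) :=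
  Subgroup.closure {Q | (Q : Matrix (Fin 2) (Fin 2) ℝ) = -1}

/-- The rectangular symmetry group: generated by `-I` and `Ref 0`. -/
noncomputable def rectGroup : Subgroup ↥(Matrix.orthogonalGroup (Fin 2) ℝ) :=
  Subgroup.closure
    {Q | (Q : Matrix (Fin 2) (Fin 2) ℝ) = -1 ∨ (Q : Matrix (Fin 2) (Fin 2) ℝ) = Ref 0}

/-- The square symmetry group: generated by `-I`, `Ref 0` and `Ref (π/4)`. -/
noncomputable def squareGroup : Subgroup ↥(Matrix.orthogonalGroup (Fin 2) ℝ) :=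
  Subgroup.closure
    {Q | (Q : Matrix (Fin 2) (Fin 2) ℝ) = -1 ∨ (Q : Matrix (Fin 2) (Fin 2) ℝ) = Ref 0 ∨
      (Q : Matrix (Fin 2) (Fin 2) ℝ) = Ref (π/4)}

/-- The isotropic symmetry group: all of O(2). -/
def isoGroup : Subgroup ↥(Matrix.orthogonalGroup (Fin 2) ℝ) := ⊤

noncomputable def rotC (u : ℂ) : Matrix (Fin 2) (Fin 2) ℝ := !![u.re, -u.im; u.im, u.re]

noncomputable def refC (u : ℂ) : Matrix (Fin 2) (Fin 2) ℝ := !![u.re, u.im; u.im, -u.re]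

lemma rot_mul_rot (u v : ℂ) : rotC u * rotC v = rotC (u * v) := by
  ext i j; fin_cases i <;> fin_cases j <;> simp [rotC, Matrix.mul_apply, Fin.sum_univ_two] <;> ring

lemma rot_mul_ref (u v : ℂ) : rotC u * refC v = refC (u * v) := by
  ext i j; fin_cases i <;> fin_cases j <;>
    simp [rotC, refC, Matrix.mul_apply, Fin.sum_univ_two] <;> ring

lemma ref_mul_rot (u v : ℂ) : refC u * rotC v = refC (u * star v) := by
  ext i j; fin_cases i <;> fin_cases j <;>
    simp [rotC, refC, Matrix.mul_apply, Fin.sum_univ_two] <;> ring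

lemma ref_mul_ref (u v : ℂ) : refC u * refC v = rotC (u * star v) := by
  ext i j; fin_cases i <;> fin_cases j <;>
    simp [rotC, refC, Matrix.mul_apply, Fin.sum_univ_two] <;> ring

lemma rot_one : rotC 1 = 1 := by
  ext i j; fin_cases i <;> fin_cases j <;> simp [rotC]

lemma rot_neg_one : rotC (-1) = -1 := by
  ext i j; fin_cases i <;> fin_cases j <;> simp [rotC]

lemma rot_transpose (u : ℂ) : (rotC u)ᵀ = rotC (star u) := by
  ext i j; fin_cases i <;> fin_cases j <;> simp [rotC]

lemma ref_transpose (u : ℂ) : (refC u)ᵀ = refC u := by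
  ext i j; fin_cases i <;> fin_cases j <;> simp [refC]

lemma unit_iff (u : ℂ) : u * star u = 1 ↔ u.re ^ 2 + u.im ^ 2 = 1 := by
  rw [Complex.ext_iff]
  simp
  constructor
  · rintro ⟨h, -⟩; linarith
  · intro h; constructor <;> linarith

lemma rot_mem {u : ℂ} (h : u * star u = 1) : rotC u ∈ Matrix.orthogonalGroup (Fin 2) ℝ := by
  rw [Matrix.mem_orthogonalGroup_iff, rot_transpose, rot_mul_rot, h, rot_one]

lemma ref_mem {u : ℂ} (h : u * star u = 1) : refC u ∈ Matrix.orthogonalGroup (Fin 2) ℝ := by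
  rw [Matrix.mem_orthogonalGroup_iff, ref_transpose, ref_mul_ref, h, rot_one]

lemma orth_cases {M : Matrix (Fin 2) (Fin 2) ℝ} (h : M ∈ Matrix.orthogonalGroup (Fin 2) ℝ) :
    ∃ u : ℂ, u * star u = 1 ∧ (M = rotC u ∨ M = refC u) := by
  have h1 := (Matrix.mem_orthogonalGroup_iff (Fin 2) ℝ).1 h
  have h2 := (Matrix.mem_orthogonalGroup_iff' (Fin 2) ℝ).1 h
  have a := congrFun (congrFun h1 0) 0
  have b := congrFun (congrFun h1 0) 1
  have c := congrFun (congrFun h1 1) 1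
  have d := congrFun (congrFun h2 0) 0
  have e := congrFun (congrFun h2 0) 1
  have f := congrFun (congrFun h2 1) 1
  simp [Matrix.mul_apply, Fin.sum_univ_two, Matrix.star_apply] at a b c d e f
  refine ⟨⟨M 0 0, M 1 0⟩, ?_, ?_⟩
  · rw [unit_iff]; simp; linarith
  · have g : (M 1 1 - M 0 0) * (M 1 1 + M 0 0) = 0 := by linarith
    have g' : (M 0 1 - M 1 0) * (M 0 1 + M 1 0) = 0 := by linarith
    have key : (M 1 1 = M 0 0 ∧ M 0 1 = - M 1 0) ∨ (M 1 1 = - M 0 0 ∧ M 0 1 = M 1 0) := by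
      rcases mul_eq_zero.1 g with g | g <;> rcases mul_eq_zero.1 g' with g' | g'
      · have p : M 1 1 = M 0 0 := by linarith
        have q : M 0 1 = M 1 0 := by linarith
        rw [p, q] at e
        have : M 0 0 * M 1 0 = 0 := by linarith
        rcases mul_eq_zero.1 this with z | z
        · right; exact ⟨by rw [p, z]; simp, q⟩
        · left; exact ⟨p, by rw [q, z]; simp⟩
      · left; exact ⟨by linarith, by linarith⟩
      · right; exact ⟨by linarith, by linarith⟩
      · have p : M 1 1 = -M 0 0 := by linarith
        have q : M 0 1 = -M 1 0 := by linarith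
        rw [p, q] at e
        have : M 0 0 * M 1 0 = 0 := by linarith
        rcases mul_eq_zero.1 this with z | z
        · left; exact ⟨by rw [p, z]; simp, q⟩
        · right; exact ⟨p, by rw [q, z]; simp⟩
    rcases key with ⟨p, q⟩ | ⟨p, q⟩
    · left; ext i j; fin_cases i <;> fin_cases j <;> simp [rotC, p, q]
    · right; ext i j; fin_cases i <;> fin_cases j <;> simp [refC, p, q]

def mkT (a b c d e f : ℝ) : Fin 2 → Fin 2 → Fin 2 → Fin 2 → ℝ :=
  ![![![![a, e], ![e, c]], ![![e, d], ![d, f]]], ![![![e, d], ![d, f]], ![![c, f], ![f, b]]]]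

lemma elast_eq {C : Fin 2 → Fin 2 → Fin 2 → Fin 2 → ℝ} (h : IsElast2 C) :
    C = mkT (C 0 0 0 0) (C 1 1 1 1) (C 0 0 1 1) (C 0 1 0 1) (C 0 0 0 1) (C 1 1 0 1) := by
  obtain ⟨h1, h2, h3⟩ := h
  funext i j k l
  fin_cases i <;> fin_cases j <;> fin_cases k <;> fin_cases l <;> simp [mkT] <;> grind

noncomputable def A2 (C : Fin 2 → Fin 2 → Fin 2 → Fin 2 → ℝ) : ℂ :=
  ⟨C 0 0 0 0 - C 1 1 1 1, 2 * (C 0 0 0 1 + C 1 1 0 1)⟩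

noncomputable def A4 (C : Fin 2 → Fin 2 → Fin 2 → Fin 2 → ℝ) : ℂ :=
  ⟨C 0 0 0 0 + C 1 1 1 1 - 2 * C 0 0 1 1 - 4 * C 0 1 0 1, 4 * (C 0 0 0 1 - C 1 1 0 1)⟩

def act (Q : Matrix (Fin 2) (Fin 2) ℝ) (C : Fin 2 → Fin 2 → Fin 2 → Fin 2 → ℝ) :
    Fin 2 → Fin 2 → Fin 2 → Fin 2 → ℝ := fun i j k l =>
  ∑ p, ∑ q, ∑ r, ∑ s, Q i p * Q j q * Q k r * Q l s * C p q r s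

lemma act_elast (Q : Matrix (Fin 2) (Fin 2) ℝ) {C : Fin 2 → Fin 2 → Fin 2 → Fin 2 → ℝ}
    (h : IsElast2 C) : IsElast2 (act Q C) := by
  rw [elast_eq h]
  refine ⟨?_, ?_, ?_⟩ <;> intro i j k l <;> simp [act, mkT, Fin.sum_univ_two] <;> ring

def I1 (C : Fin 2 → Fin 2 → Fin 2 → Fin 2 → ℝ) : ℝ := C 0 0 0 0 + C 1 1 1 1 + 2 * C 0 0 1 1

def I2 (C : Fin 2 → Fin 2 → Fin 2 → Fin 2 → ℝ) : ℝ := C 0 0 0 0 + C 1 1 1 1 + 2 * C 0 1 0 1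

lemma elast_ext {C D : Fin 2 → Fin 2 → Fin 2 → Fin 2 → ℝ} (hC : IsElast2 C) (hD : IsElast2 D)
    (h1 : I1 C = I1 D) (h2 : I2 C = I2 D) (h3 : A2 C = A2 D) (h4 : A4 C = A4 D) : C = D := by
  rw [Complex.ext_iff] at h3 h4
  simp only [A2, A4, I1, I2] at h1 h2 h3 h4
  obtain ⟨h3, h3'⟩ := h3
  obtain ⟨h4, h4'⟩ := h4
  rw [elast_eq hC, elast_eq hD]
  congr 1 <;> linarith

section inv
variable {C : Fin 2 → Fin 2 → Fin 2 → Fin 2 → ℝ} {u : ℂ}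

lemma I1_rot (h : IsElast2 C) (hu : u * star u = 1) : I1 (act (rotC u) C) = I1 C := by
  rw [unit_iff] at hu
  rw [elast_eq h]
  have : I1 C = (u.re ^ 2 + u.im ^ 2) ^ 2 * I1 C := by rw [hu]; ring
  rw [elast_eq h] at this
  rw [this]
  simp [I1, act, rotC, mkT, Fin.sum_univ_two]; ring

lemma I1_ref (h : IsElast2 C) (hu : u * star u = 1) : I1 (act (refC u) C) = I1 C := by
  rw [unit_iff] at hu
  rw [elast_eq h]
  have : I1 C = (u.re ^ 2 + u.im ^ 2) ^ 2 * I1 C := by rw [hu]; ring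
  rw [elast_eq h] at this
  rw [this]
  simp [I1, act, refC, mkT, Fin.sum_univ_two]; ring

lemma I2_rot (h : IsElast2 C) (hu : u * star u = 1) : I2 (act (rotC u) C) = I2 C := by
  rw [unit_iff] at hu
  rw [elast_eq h]
  have : I2 C = (u.re ^ 2 + u.im ^ 2) ^ 2 * I2 C := by rw [hu]; ring
  rw [elast_eq h] at this
  rw [this]
  simp [I2, act, rotC, mkT, Fin.sum_univ_two]; ring

lemma I2_ref (h : IsElast2 C) (hu : u * star u = 1) : I2 (act (refC u) C) = I2 C := by
  rw [unit_iff] at hu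
  rw [elast_eq h]
  have : I2 C = (u.re ^ 2 + u.im ^ 2) ^ 2 * I2 C := by rw [hu]; ring
  rw [elast_eq h] at this
  rw [this]
  simp [I2, act, refC, mkT, Fin.sum_univ_two]; ring

lemma A2_rot (h : IsElast2 C) (hu : u * star u = 1) : A2 (act (rotC u) C) = u ^ 2 * A2 C := by
  have : u ^ 2 * A2 C = (u * star u) * (u ^ 2 * A2 C) := by rw [hu]; ring
  rw [this, elast_eq h]
  apply Complex.ext <;>
    simp [A2, act, rotC, mkT, Fin.sum_univ_two, pow_succ] <;> ring

lemma A2_ref (h : IsElast2 C) (hu : u * star u = 1) :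
    A2 (act (refC u) C) = u ^ 2 * star (A2 C) := by
  have : u ^ 2 * star (A2 C) = (u * star u) * (u ^ 2 * star (A2 C)) := by rw [hu]; ring
  rw [this, elast_eq h]
  apply Complex.ext <;>
    simp [A2, act, refC, mkT, Fin.sum_univ_two, pow_succ] <;> ring

lemma A4_rot (h : IsElast2 C) : A4 (act (rotC u) C) = u ^ 4 * A4 C := by
  rw [elast_eq h]
  apply Complex.ext <;>
    simp [A4, act, rotC, mkT, Fin.sum_univ_two, pow_succ] <;> ring

lemma A4_ref (h : IsElast2 C) : A4 (act (refC u) C) = u ^ 4 * star (A4 C) := by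
  rw [elast_eq h]
  apply Complex.ext <;>
    simp [A4, act, refC, mkT, Fin.sum_univ_two, pow_succ] <;> ring

lemma sym_iff {Q : Matrix (Fin 2) (Fin 2) ℝ} : IsSymTrans C Q ↔ act Q C = C :=
  ⟨fun h => by funext i j k l; exact (h i j k l).symm, fun h i j k l => by
    conv_lhs => rw [← h]
    rfl⟩

lemma sym_rot (h : IsElast2 C) (hu : u * star u = 1) :
    IsSymTrans C (rotC u) ↔ u ^ 2 * A2 C = A2 C ∧ u ^ 4 * A4 C = A4 C := by
  rw [sym_iff]
  constructor
  · intro e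
    rw [← A2_rot h hu, ← A4_rot h, e]; simp
  · rintro ⟨e1, e2⟩
    exact elast_ext (act_elast _ h) h (I1_rot h hu) (I2_rot h hu) ((A2_rot h hu).trans e1)
      ((A4_rot h).trans e2)

lemma sym_ref (h : IsElast2 C) (hu : u * star u = 1) :
    IsSymTrans C (refC u) ↔ u ^ 2 * star (A2 C) = A2 C ∧ u ^ 4 * star (A4 C) = A4 C := by
  rw [sym_iff]
  constructor
  · intro e
    rw [← A2_ref h hu, ← A4_ref h, e]; simp
  · rintro ⟨e1, e2⟩
    exact elast_ext (act_elast _ h) h (I1_ref h hu) (I2_ref h hu) ((A2_ref h hu).trans e1)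
      ((A4_ref h).trans e2)

end inv

lemma image_iff {C : Fin 2 → Fin 2 → Fin 2 → Fin 2 → ℝ} (h : IsElast2 C) {w : ℂ}
    (hw : w * star w = 1) (N : Matrix (Fin 2) (Fin 2) ℝ) :
    N ∈ (fun M => rotC w * M * (rotC w)ᵀ) ''
              {M : Matrix (Fin 2) (Fin 2) ℝ |
                M ∈ Matrix.orthogonalGroup (Fin 2) ℝ ∧ IsSymTrans C M} ↔
    ∃ v : ℂ, v * star v = 1 ∧
      ((N = rotC v ∧ v ^ 2 * (w ^ 2 * A2 C) = w ^ 2 * A2 C ∧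
          v ^ 4 * (w ^ 4 * A4 C) = w ^ 4 * A4 C) ∨
       (N = refC v ∧ v ^ 2 * star (w ^ 2 * A2 C) = w ^ 2 * A2 C ∧
          v ^ 4 * star (w ^ 4 * A4 C) = w ^ 4 * A4 C)) := by
  have hw' : star w * w = 1 := by rw [mul_comm]; exact hw
  have hsw : star w * star (star w) = 1 := by rw [star_star]; exact hw'
  have p2 : w ^ 2 * (star w) ^ 2 = 1 := by rw [← mul_pow, hw, one_pow]
  have p4 : w ^ 4 * (star w) ^ 4 = 1 := by rw [← mul_pow, hw, one_pow]
  constructor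
  · rintro ⟨M, ⟨hM, hs⟩, rfl⟩
    obtain ⟨u, hu, rfl | rfl⟩ := orth_cases hM
    · rw [sym_rot h hu] at hs
      refine ⟨u, hu, Or.inl ⟨?_, ?_, ?_⟩⟩
      · simp only [rot_transpose, rot_mul_rot]
        congr 1
        linear_combination u * hw
      · linear_combination w ^ 2 * hs.1
      · linear_combination w ^ 4 * hs.2
    · rw [sym_ref h hu] at hs
      refine ⟨w * u * w, ?_, Or.inr ⟨?_, ?_, ?_⟩⟩
      · simp only [star_mul]
        linear_combination (w * star w * (w * star w)) * hu + (w * star w + 1) * hw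
      · simp only [rot_transpose, rot_mul_ref, ref_mul_rot, star_star]
      · simp only [star_mul, star_pow]
        linear_combination w ^ 2 * hs.1 + u ^ 2 * w ^ 2 * star (A2 C) * p2
      · simp only [star_mul, star_pow]
        linear_combination w ^ 4 * hs.2 + u ^ 4 * w ^ 4 * star (A4 C) * p4
  · rintro ⟨v, hv, ⟨rfl, h1, h2⟩ | ⟨rfl, h1, h2⟩⟩
    · refine ⟨rotC v, ⟨rot_mem hv, (sym_rot h hv).2 ⟨?_, ?_⟩⟩, ?_⟩
      · linear_combination (star w) ^ 2 * h1 - (v ^ 2 * A2 C - A2 C) * p2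
      · linear_combination (star w) ^ 4 * h2 - (v ^ 4 * A4 C - A4 C) * p4
      · simp only [rot_transpose, rot_mul_rot]
        congr 1
        linear_combination v * hw
    · have hu : (star w * v * star w) * star (star w * v * star w) = 1 := by
        simp only [star_mul, star_star]
        linear_combination (w * star w * (w * star w)) * hv + (w * star w + 1) * hw
      refine ⟨refC (star w * v * star w), ⟨ref_mem hu, (sym_ref h hu).2 ⟨?_, ?_⟩⟩, ?_⟩
      · simp only [star_mul, star_pow] at h1
        linear_combination (star w) ^ 2 * h1 + (A2 C) * p2
      · simp only [star_mul, star_pow] at h2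
        linear_combination (star w) ^ 4 * h2 + (A4 C) * p4
      · simp only [rot_transpose, rot_mul_ref, ref_mul_rot, star_star]
        congr 1
        linear_combination (v * (w * star w + 1)) * hw

lemma Ref_zero : Ref 0 = refC 1 := by
  ext i j; fin_cases i <;> fin_cases j <;> simp [Ref, refC]

lemma Ref_quarter : Ref (π / 4) = refC Complex.I := by
  have : 2 * (π / 4) = π / 2 := by ring
  ext i j; fin_cases i <;> fin_cases j <;> simp [Ref, refC, this]

lemma star_root {u : ℂ} {n : ℕ} (h : u ^ n = 1) : (star u) ^ n = 1 := by
  rw [← star_pow, h, star_one]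

lemma inv_val (Q : ↥(Matrix.orthogonalGroup (Fin 2) ℝ)) :
    ((Q⁻¹ : ↥(Matrix.orthogonalGroup (Fin 2) ℝ)) : Matrix (Fin 2) (Fin 2) ℝ) =
      (Q : Matrix (Fin 2) (Fin 2) ℝ)ᵀ := by
  rw [← Matrix.conjTranspose_eq_transpose_of_trivial]; rfl

/-- elements of a closure of roots -/
lemma closure_sub (n : ℕ) (S : Set ↥(Matrix.orthogonalGroup (Fin 2) ℝ))
    (hS : ∀ Q ∈ S, ∃ v : ℂ, v ^ n = 1 ∧
      ((Q : Matrix (Fin 2) (Fin 2) ℝ) = rotC v ∨ (Q : Matrix (Fin 2) (Fin 2) ℝ) = refC v))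
    (Q : ↥(Matrix.orthogonalGroup (Fin 2) ℝ)) (hQ : Q ∈ Subgroup.closure S) :
    ∃ v : ℂ, v ^ n = 1 ∧
      ((Q : Matrix (Fin 2) (Fin 2) ℝ) = rotC v ∨ (Q : Matrix (Fin 2) (Fin 2) ℝ) = refC v) := by
  induction hQ using Subgroup.closure_induction with
  | mem x hx => exact hS x hx
  | one => exact ⟨1, one_pow _, Or.inl (by rw [rot_one]; rfl)⟩
  | mul x y hx hy ix iy =>
    obtain ⟨u, hu, eu⟩ := ix
    obtain ⟨v, hv, ev⟩ := iy
    have h1 : (u * v) ^ n = 1 := by rw [mul_pow, hu, hv, one_mul]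
    have h2 : (u * star v) ^ n = 1 := by rw [mul_pow, hu, star_root hv, one_mul]
    rcases eu with eu | eu <;> rcases ev with ev | ev
    · exact ⟨_, h1, Or.inl (by rw [Submonoid.coe_mul, eu, ev, rot_mul_rot])⟩
    · exact ⟨_, h1, Or.inr (by rw [Submonoid.coe_mul, eu, ev, rot_mul_ref])⟩
    · exact ⟨_, h2, Or.inr (by rw [Submonoid.coe_mul, eu, ev, ref_mul_rot])⟩
    · exact ⟨_, h2, Or.inl (by rw [Submonoid.coe_mul, eu, ev, ref_mul_ref])⟩
  | inv x hx ix =>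
    obtain ⟨u, hu, eu | eu⟩ := ix
    · exact ⟨_, star_root hu, Or.inl (by rw [inv_val, eu, rot_transpose])⟩
    · exact ⟨_, hu, Or.inr (by rw [inv_val, eu, ref_transpose])⟩

lemma unit_of_root {v : ℂ} {n : ℕ} (hn : n ≠ 0) (h : v ^ n = 1) : v * star v = 1 := by
  have h1 : ‖v‖ = 1 := Complex.norm_eq_one_of_pow_eq_one h hn
  have : v * star v = ((‖v‖ ^ 2 : ℝ) : ℂ) := by
    rw [← Complex.normSq_eq_norm_sq]; exact Complex.mul_conj v
  rw [this, h1]; simp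

lemma val_mem_iff (G : Subgroup ↥(Matrix.orthogonalGroup (Fin 2) ℝ))
    (N : Matrix (Fin 2) (Fin 2) ℝ) :
    N ∈ Subtype.val '' (G : Set ↥(Matrix.orthogonalGroup (Fin 2) ℝ)) ↔
      ∃ h : N ∈ Matrix.orthogonalGroup (Fin 2) ℝ, (⟨N, h⟩ : ↥(Matrix.orthogonalGroup (Fin 2) ℝ)) ∈ G := by
  simp

lemma mem_one : (1 : ℂ) * star 1 = 1 := by simp
lemma mem_neg : (-1 : ℂ) * star (-1) = 1 := by simp
lemma mem_I : Complex.I * star Complex.I = 1 := by simp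

lemma sq_eq_one_cases {v : ℂ} (hv : v ^ 2 = 1) : v = 1 ∨ v = -1 := by
  have : (v - 1) * (v + 1) = 0 := by linear_combination hv
  exact (mul_eq_zero.1 this).imp sub_eq_zero.1 eq_neg_of_add_eq_zero_left

lemma oblique_iff (N : Matrix (Fin 2) (Fin 2) ℝ) :
    N ∈ Subtype.val '' (obliqueGroup : Set ↥(Matrix.orthogonalGroup (Fin 2) ℝ)) ↔
      ∃ v : ℂ, v ^ 2 = 1 ∧ N = rotC v := by
  rw [val_mem_iff]
  constructor
  · rintro ⟨h, hN⟩
    have : ∀ Q ∈ obliqueGroup, ∃ v : ℂ, v ^ 2 = 1 ∧ (Q : Matrix (Fin 2) (Fin 2) ℝ) = rotC v := by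
      intro Q hQ
      induction hQ using Subgroup.closure_induction with
      | mem x hx => exact ⟨-1, by norm_num, by rw [rot_neg_one]; exact hx⟩
      | one => exact ⟨1, one_pow _, by rw [rot_one]; rfl⟩
      | mul x y hx hy ix iy =>
        obtain ⟨u, hu, eu⟩ := ix
        obtain ⟨v, hv, ev⟩ := iy
        exact ⟨u * v, by rw [mul_pow, hu, hv, one_mul],
          by rw [Submonoid.coe_mul, eu, ev, rot_mul_rot]⟩
      | inv x hx ix =>
        obtain ⟨u, hu, eu⟩ := ix
        exact ⟨_, star_root hu, by rw [inv_val, eu, rot_transpose]⟩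
    exact this _ hN
  · rintro ⟨v, hv, rfl⟩
    refine ⟨rot_mem (unit_of_root two_ne_zero hv), ?_⟩
    rcases (sq_eq_one_cases hv) with rfl | rfl
    · convert obliqueGroup.one_mem
      exact rot_one
    · exact Subgroup.subset_closure rot_neg_one

lemma rect_iff (N : Matrix (Fin 2) (Fin 2) ℝ) :
    N ∈ Subtype.val '' (rectGroup : Set ↥(Matrix.orthogonalGroup (Fin 2) ℝ)) ↔
      ∃ v : ℂ, v ^ 2 = 1 ∧ (N = rotC v ∨ N = refC v) := by
  rw [val_mem_iff]
  constructor
  · rintro ⟨h, hN⟩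
    refine closure_sub 2 _ ?_ _ hN
    rintro Q (hQ | hQ)
    · exact ⟨-1, by norm_num, Or.inl (by rw [hQ, rot_neg_one])⟩
    · exact ⟨1, by norm_num, Or.inr (by rw [hQ, Ref_zero])⟩
  · have m1 : (⟨rotC (-1), rot_mem mem_neg⟩ : ↥(Matrix.orthogonalGroup (Fin 2) ℝ)) ∈ rectGroup :=
      Subgroup.subset_closure (Or.inl rot_neg_one)
    have m2 : (⟨refC 1, ref_mem mem_one⟩ : ↥(Matrix.orthogonalGroup (Fin 2) ℝ)) ∈ rectGroup :=
      Subgroup.subset_closure (Or.inr Ref_zero.symm)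
    rintro ⟨v, hv, hN⟩
    have hu := unit_of_root two_ne_zero hv
    have hr : ∃ h, (⟨rotC v, h⟩ : ↥(Matrix.orthogonalGroup (Fin 2) ℝ)) ∈ rectGroup := by
      refine ⟨rot_mem hu, ?_⟩
      rcases (sq_eq_one_cases hv) with rfl | rfl
      · convert rectGroup.one_mem
        exact rot_one
      · exact m1
    rcases hN with rfl | rfl
    · exact hr
    · obtain ⟨h, hr⟩ := hr
      refine ⟨ref_mem hu, ?_⟩
      convert rectGroup.mul_mem hr m2
      simp [rot_mul_ref]

lemma square_iff (N : Matrix (Fin 2) (Fin 2) ℝ) :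
    N ∈ Subtype.val '' (squareGroup : Set ↥(Matrix.orthogonalGroup (Fin 2) ℝ)) ↔
      ∃ v : ℂ, v ^ 4 = 1 ∧ (N = rotC v ∨ N = refC v) := by
  rw [val_mem_iff]
  constructor
  · rintro ⟨h, hN⟩
    refine closure_sub 4 _ ?_ _ hN
    rintro Q (hQ | hQ | hQ)
    · exact ⟨-1, by norm_num, Or.inl (by rw [hQ, rot_neg_one])⟩
    · exact ⟨1, by norm_num, Or.inr (by rw [hQ, Ref_zero])⟩
    · exact ⟨Complex.I, Complex.I_pow_four, Or.inr (by rw [hQ, Ref_quarter])⟩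
  · have m1 : (⟨rotC (-1), rot_mem mem_neg⟩ : ↥(Matrix.orthogonalGroup (Fin 2) ℝ)) ∈ squareGroup :=
      Subgroup.subset_closure (Or.inl rot_neg_one)
    have m2 : (⟨refC 1, ref_mem mem_one⟩ : ↥(Matrix.orthogonalGroup (Fin 2) ℝ)) ∈ squareGroup :=
      Subgroup.subset_closure (Or.inr (Or.inl Ref_zero.symm))
    have m3 : (⟨refC Complex.I, ref_mem mem_I⟩ : ↥(Matrix.orthogonalGroup (Fin 2) ℝ)) ∈
        squareGroup := Subgroup.subset_closure (Or.inr (Or.inr Ref_quarter.symm))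
    have m4 : (⟨rotC Complex.I, rot_mem mem_I⟩ : ↥(Matrix.orthogonalGroup (Fin 2) ℝ)) ∈
        squareGroup := by
      convert squareGroup.mul_mem m3 m2
      simp [ref_mul_ref]
    rintro ⟨v, hv, hN⟩
    have hu := unit_of_root four_ne_zero hv
    have hr : ∃ h, (⟨rotC v, h⟩ : ↥(Matrix.orthogonalGroup (Fin 2) ℝ)) ∈ squareGroup := by
      refine ⟨rot_mem hu, ?_⟩
      have hf : (v - 1) * ((v + 1) * ((v - Complex.I) * (v + Complex.I))) = 0 := by
        linear_combination hv - (v ^ 2 - 1) * Complex.I_sq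
      rcases mul_eq_zero.1 hf with h | h
      · have : v = 1 := sub_eq_zero.1 h
        subst this
        convert squareGroup.one_mem
        exact rot_one
      rcases mul_eq_zero.1 h with h | h
      · have : v = -1 := eq_neg_of_add_eq_zero_left h
        subst this
        exact m1
      rcases mul_eq_zero.1 h with h | h
      · have : v = Complex.I := sub_eq_zero.1 h
        subst this
        exact m4
      · have : v = -Complex.I := eq_neg_of_add_eq_zero_left h
        subst this
        convert squareGroup.mul_mem m1 m4
        simp [rot_mul_rot]
    rcases hN with rfl | rfl
    · exact hr
    · obtain ⟨h, hr⟩ := hr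
      refine ⟨ref_mem hu, ?_⟩
      convert squareGroup.mul_mem hr m2
      simp [rot_mul_ref]

lemma iso_iff (N : Matrix (Fin 2) (Fin 2) ℝ) :
    N ∈ Subtype.val '' (isoGroup : Set ↥(Matrix.orthogonalGroup (Fin 2) ℝ)) ↔
      ∃ v : ℂ, v * star v = 1 ∧ (N = rotC v ∨ N = refC v) := by
  rw [val_mem_iff]
  constructor
  · rintro ⟨h, -⟩
    exact orth_cases h
  · rintro ⟨v, hv, rfl | rfl⟩
    · exact ⟨rot_mem hv, Subgroup.mem_top _⟩
    · exact ⟨ref_mem hv, Subgroup.mem_top _⟩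

lemma exists_phase (A : ℂ) (n : ℕ) (hn : n ≠ 0) :
    ∃ w : ℂ, w * star w = 1 ∧ w ^ n * A = (‖A‖ : ℂ) := by
  have hn' : (n : ℂ) ≠ 0 := Nat.cast_ne_zero.2 hn
  refine ⟨Complex.exp (((-A.arg / n : ℝ) : ℂ) * Complex.I), ?_, ?_⟩
  · have h1 := Complex.norm_exp_ofReal_mul_I (-A.arg / n)
    have := Complex.mul_conj (Complex.exp (((-A.arg / n : ℝ) : ℂ) * Complex.I))
    rw [Complex.normSq_eq_norm_sq, h1] at this
    simpa using this
  · conv_lhs =>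
      arg 2
      rw [← Complex.norm_mul_exp_arg_mul_I A]
    rw [← Complex.exp_nat_mul, mul_left_comm, ← Complex.exp_add]
    have : (n : ℂ) * (((-A.arg / n : ℝ) : ℂ) * Complex.I) + A.arg * Complex.I = 0 := by
      push_cast
      field_simp
      ring
    rw [this]; simp

lemma classify {C : Fin 2 → Fin 2 → Fin 2 → Fin 2 → ℝ} (hC : IsElast2 C) :
    ∃ w : ℂ, w * star w = 1 ∧ ∃ G : Subgroup ↥(Matrix.orthogonalGroup (Fin 2) ℝ),
      (G = obliqueGroup ∨ G = rectGroup ∨ G = squareGroup ∨ G = isoGroup) ∧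
          (fun M => rotC w * M * (rotC w)ᵀ) ''
              {M : Matrix (Fin 2) (Fin 2) ℝ |
                M ∈ Matrix.orthogonalGroup (Fin 2) ℝ ∧ IsSymTrans C M}
            = Subtype.val '' (G : Set ↥(Matrix.orthogonalGroup (Fin 2) ℝ)) := by
  by_cases h2 : A2 C = 0
  · by_cases h4 : A4 C = 0
    · refine ⟨1, mem_one, isoGroup, by simp, ?_⟩
      ext N
      rw [image_iff hC mem_one, iso_iff]
      simp [h2, h4]
    · obtain ⟨w, hw, e⟩ := exists_phase (A4 C) 4 four_ne_zero
      refine ⟨w, hw, squareGroup, by simp, ?_⟩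
      ext N
      rw [image_iff hC hw, square_iff, e, h2]
      have hz : (‖A4 C‖ : ℂ) ≠ 0 := by simpa using h4
      have hs : star (‖A4 C‖ : ℂ) = ‖A4 C‖ := Complex.conj_ofReal _
      rw [hs]
      simp only [mul_zero, star_zero, true_and, mul_eq_right₀ hz]
      constructor
      · rintro ⟨v, -, ⟨a, b⟩ | ⟨a, b⟩⟩
        exacts [⟨v, b, Or.inl a⟩, ⟨v, b, Or.inr a⟩]
      · rintro ⟨v, b, a⟩
        exact ⟨v, unit_of_root four_ne_zero b, a.imp (fun a => ⟨a, b⟩) (fun a => ⟨a, b⟩)⟩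
  · obtain ⟨w, hw, e⟩ := exists_phase (A2 C) 2 two_ne_zero
    have hz : (‖A2 C‖ : ℂ) ≠ 0 := by simpa using h2
    have hs : star (‖A2 C‖ : ℂ) = ‖A2 C‖ := Complex.conj_ofReal _
    have sq4 : ∀ v : ℂ, v ^ 2 = 1 → v ^ 4 = 1 := fun v hv => by
      linear_combination (v ^ 2 + 1) * hv
    by_cases h4 : star (w ^ 4 * A4 C) = w ^ 4 * A4 C
    · refine ⟨w, hw, rectGroup, by simp, ?_⟩
      ext N
      rw [image_iff hC hw, rect_iff, e, hs, h4]
      simp only [mul_eq_right₀ hz]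
      constructor
      · rintro ⟨v, -, ⟨a, b, -⟩ | ⟨a, b, -⟩⟩
        exacts [⟨v, b, Or.inl a⟩, ⟨v, b, Or.inr a⟩]
      · rintro ⟨v, b, a⟩
        have c : v ^ 4 * (w ^ 4 * A4 C) = w ^ 4 * A4 C := by rw [sq4 v b, one_mul]
        exact ⟨v, unit_of_root two_ne_zero b, a.imp (fun a => ⟨a, b, c⟩) (fun a => ⟨a, b, c⟩)⟩
    · refine ⟨w, hw, obliqueGroup, by simp, ?_⟩
      ext N
      rw [image_iff hC hw, oblique_iff, e, hs]
      simp only [mul_eq_right₀ hz]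
      constructor
      · rintro ⟨v, -, ⟨a, b, -⟩ | ⟨a, b, c⟩⟩
        · exact ⟨v, b, a⟩
        · rw [sq4 v b, one_mul] at c
          exact absurd c h4
      · rintro ⟨v, b, a⟩
        have c : v ^ 4 * (w ^ 4 * A4 C) = w ^ 4 * A4 C := by rw [sq4 v b, one_mul]
        exact ⟨v, unit_of_root two_ne_zero b, Or.inl ⟨a, b, c⟩⟩

lemma rect_cond {C : Fin 2 → Fin 2 → Fin 2 → Fin 2 → ℝ} (hC : IsElast2 C)
    (h : IsSymTrans C (refC 1)) : C 0 0 0 1 = 0 ∧ C 1 1 0 1 = 0 := by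
  obtain ⟨h1, h2⟩ := (sym_ref hC mem_one).1 h
  have h1 := congrArg Complex.im h1
  have h2 := congrArg Complex.im h2
  simp [A2, A4] at h1 h2
  constructor <;> linarith

lemma square_cond {C : Fin 2 → Fin 2 → Fin 2 → Fin 2 → ℝ} (hC : IsElast2 C)
    (h : IsSymTrans C (refC Complex.I)) : C 0 0 0 0 = C 1 1 1 1 := by
  obtain ⟨h1, h2⟩ := (sym_ref hC mem_I).1 h
  have h1 := congrArg Complex.re h1
  simp [A2] at h1
  linarith

lemma iso_cond {C : Fin 2 → Fin 2 → Fin 2 → Fin 2 → ℝ} (hC : IsElast2 C)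
    (h : ∀ v : ℂ, v * star v = 1 → IsSymTrans C (rotC v)) : A4 C = 0 := by
  have hu : (⟨3 / 5, 4 / 5⟩ : ℂ) * star (⟨3 / 5, 4 / 5⟩ : ℂ) = 1 := by
    rw [unit_iff]; norm_num
  obtain ⟨-, h2⟩ := (sym_rot hC hu).1 (h _ hu)
  by_contra h0
  rw [mul_eq_right₀ h0] at h2
  have := congrArg Complex.re h2
  simp [pow_succ] at this
  norm_num at this

/-- classification of the symmetry groups of two-dimensional
elasticity tensors, together with the corresponding restrictions on the tensor. -/
theorem statement0 :
    (∀ C : Fin 2 → Fin 2 → Fin 2 → Fin 2 → ℝ, IsElast2 C →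
      ∃ R : Matrix (Fin 2) (Fin 2) ℝ, R ∈ Matrix.orthogonalGroup (Fin 2) ℝ ∧ R.det = 1 ∧
        ∃! G : Subgroup ↥(Matrix.orthogonalGroup (Fin 2) ℝ),
          (G = obliqueGroup ∨ G = rectGroup ∨ G = squareGroup ∨ G = isoGroup) ∧
          (fun M => R * M * Rᵀ) ''
              {M : Matrix (Fin 2) (Fin 2) ℝ |
                M ∈ Matrix.orthogonalGroup (Fin 2) ℝ ∧ IsSymTrans C M}
            = Subtype.val '' (G : Set ↥(Matrix.orthogonalGroup (Fin 2) ℝ))) ∧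
    (∀ C : Fin 2 → Fin 2 → Fin 2 → Fin 2 → ℝ, IsElast2 C →
      (∀ Q : ↥(Matrix.orthogonalGroup (Fin 2) ℝ), Q ∈ rectGroup →
        IsSymTrans C (Q : Matrix (Fin 2) (Fin 2) ℝ)) →
      C 0 0 0 1 = 0 ∧ C 1 1 0 1 = 0) ∧
    (∀ C : Fin 2 → Fin 2 → Fin 2 → Fin 2 → ℝ, IsElast2 C →
      (∀ Q : ↥(Matrix.orthogonalGroup (Fin 2) ℝ), Q ∈ squareGroup →
        IsSymTrans C (Q : Matrix (Fin 2) (Fin 2) ℝ)) →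
      C 0 0 0 1 = 0 ∧ C 1 1 0 1 = 0 ∧ C 0 0 0 0 = C 1 1 1 1) ∧
    (∀ C : Fin 2 → Fin 2 → Fin 2 → Fin 2 → ℝ, IsElast2 C →
      (∀ Q : ↥(Matrix.orthogonalGroup (Fin 2) ℝ), Q ∈ isoGroup →
        IsSymTrans C (Q : Matrix (Fin 2) (Fin 2) ℝ)) →
      C 0 0 0 1 = 0 ∧ C 1 1 0 1 = 0 ∧ C 0 0 0 0 = C 1 1 1 1 ∧
        C 0 1 0 1 = (C 0 0 0 0 - C 0 0 1 1) / 2) := by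
  have key : ∀ G : Subgroup ↥(Matrix.orthogonalGroup (Fin 2) ℝ),
      ∀ C : Fin 2 → Fin 2 → Fin 2 → Fin 2 → ℝ,
      (∀ Q : ↥(Matrix.orthogonalGroup (Fin 2) ℝ), Q ∈ G →
        IsSymTrans C (Q : Matrix (Fin 2) (Fin 2) ℝ)) → ∀ N,
        N ∈ Subtype.val '' (G : Set ↥(Matrix.orthogonalGroup (Fin 2) ℝ)) → IsSymTrans C N := by
    rintro G C h _ ⟨Q, hQ, rfl⟩
    exact h Q hQ
  refine ⟨?_, ?_, ?_, ?_⟩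
  · intro C hC
    obtain ⟨w, hw, G, hG, e⟩ := classify hC
    refine ⟨rotC w, rot_mem hw, ?_, G, ⟨hG, e⟩, ?_⟩
    · rw [unit_iff] at hw
      rw [rotC, Matrix.det_fin_two_of]
      linarith
    · rintro G' ⟨-, e'⟩
      exact SetLike.coe_injective (Subtype.val_injective.image_injective (e'.symm.trans e))
  · intro C hC h
    exact rect_cond hC (key _ C h _ ((rect_iff _).2 ⟨1, by norm_num, Or.inr rfl⟩))
  · intro C hC h
    have h1 := rect_cond hC (key _ C h _ ((square_iff _).2 ⟨1, by norm_num, Or.inr rfl⟩))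
    have h2 := square_cond hC
      (key _ C h _ ((square_iff _).2 ⟨Complex.I, Complex.I_pow_four, Or.inr rfl⟩))
    exact ⟨h1.1, h1.2, h2⟩
  · intro C hC h
    have h1 := rect_cond hC (key _ C h _ ((iso_iff _).2 ⟨1, mem_one, Or.inr rfl⟩))
    have h2 := square_cond hC (key _ C h _ ((iso_iff _).2 ⟨Complex.I, mem_I, Or.inr rfl⟩))
    have h3 := iso_cond hC fun v hv => key _ C h _ ((iso_iff _).2 ⟨v, hv, Or.inl rfl⟩)
    have h3 := congrArg Complex.re h3
    simp [A4] at h3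
    exact ⟨h1.1, h1.2, h2, by linarith⟩
end

section
/- Let h > 0 and δ ≥ 2h. Let λ : ℝ² × ℝ × ℝ → ℝ, written λ(ξ₁,ξ₂,z′,z), be bounded and measurable with λ(ξ₁,ξ₂,z′,z) = λ(ξ₁,ξ₂,−z′,−z) = λ(ξ₁,ξ₂,z,z′) for all arguments, and with λ(ξ₁,ξ₂,z′,z) = 0 whenever |z| > h, or |z′| > h, or ξ₁² + ξ₂² + (z′−z)² ≥ δ². Fix t and let u : ℝ³ → ℝ³ be bounded and continuous with u₁ and u₂ even, and u₃ odd, in the third variable (u_i(x,y,−z) = u_i(x,y,z) for i = 1,2 and u₃(x,y,−z) = −u₃(x,y,z)). For a point x = (x,y,z), define the third component of the peridynamic traction in the direction e₃ by τ₃(x,y,z) := ∫₀^δ ∫_{{x′ ∈ ℝ³ : ‖x′ − (x,y,z−s)‖ < δ, z′ > z}} λ(x′−x, y′−y, z′, z−s) (z′ − (z−s)) Σ_j (x′_j − x̂_j)(u_j(x′) − u_j(x̂)) dx′ ds, where x̂ = (x,y,z−s). Then the average of τ₃ over the thickness of the plate satisfies (1/2h) ∫_{−h}^{h} τ₃(x,y,z)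 dz = (1/4h) ∫_{−h}^{h} ∫_{−h}^{h} ∫_{ℝ²} λ(ξ₁,ξ₂,z′,z) (z′−z)² [ ξ₁(u₁(x+ξ₁, y+ξ₂, z′) − u₁(x,y,z)) + ξ₂(u₂(x+ξ₁, y+ξ₂, z′) − u₂(x,y,z)) + (z′−z)(u₃(x+ξ₁, y+ξ₂, z′) − u₃(x,y,z)) ] dξ₁ dξ₂ dz′ dz. -/
open MeasureTheory

/-- Third component of the peridynamic traction at `(x,y,z)` in the direction
`e₃`, for a fixed time, displacement field `u`, position-aware micromodulus
`λ(ξ₁,ξ₂,z′,z)` and horizon `δ`. -/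
noncomputable def tau3 (δ : ℝ) (lam : ℝ → ℝ → ℝ → ℝ → ℝ)
    (u : ℝ → ℝ → ℝ → Fin 3 → ℝ) (x y z : ℝ) : ℝ :=
  ∫ s in (0:ℝ)..δ,
    ∫ p in {p : ℝ × ℝ × ℝ |
        (p.1 - x)^2 + (p.2.1 - y)^2 + (p.2.2 - (z - s))^2 < δ^2 ∧ z < p.2.2},
      lam (p.1 - x) (p.2.1 - y) p.2.2 (z - s) * (p.2.2 - (z - s)) *
        (∑ j, (![p.1 - x, p.2.1 - y, p.2.2 - (z - s)] j) *
          (u p.1 p.2.1 p.2.2 j - u x y (z - s) j))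

lemma integrable_of_bdd_supp {α : Type*} [MeasureSpace α] {f : α → ℝ} {s : Set α} (C : ℝ)
    (hf : Measurable f) (hs : MeasurableSet s) (hfin : volume s < ⊤)
    (hC : ∀ a, |f a| ≤ C) (h0 : ∀ a, a ∉ s → f a = 0) : Integrable f := by
  have h1 : IntegrableOn f s volume :=
    Measure.integrableOn_of_bounded (M := C) hfin.ne hf.aestronglyMeasurable
      (Filter.Eventually.of_forall fun a => by simpa using hC a)
  rw [integrableOn_iff_integrable_of_support_subset] at h1
  · exact h1
  · intro a ha
    by_contra hn
    exact ha (h0 a hn)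

lemma box_fin (a b c d : ℝ) : volume (Set.Icc a b ×ˢ Set.Icc c d : Set (ℝ × ℝ)) < ⊤ := by
  exact (isCompact_Icc.prod isCompact_Icc).measure_lt_top

lemma lemA (h δ : ℝ) (hh : 0 < h) (hδ : 2*h ≤ δ) (W : ℝ → ℝ → ℝ) (C : ℝ)
    (hW : Measurable fun p : ℝ × ℝ => W p.1 p.2) (hC : ∀ z' a, |W z' a| ≤ C)
    (h0 : ∀ z' a, (h < |a| ∨ h < |z'|) → W z' a = 0)
    (hodd : ∀ z' a, W (-z') (-a) = - W z' a) :
    ∫ z in (-h)..h, ∫ s in (0:ℝ)..δ, ∫ z' in Set.Ioi z, W z' (z - s)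
      = (1/2) * ∫ z in (-h)..h, ∫ z' in (-h)..h, (z' - z) * W z' z := by
  have hC0 : 0 ≤ C := (abs_nonneg _).trans (hC 0 0)
  -- support in the box
  have hbox : ∀ p : ℝ × ℝ, p ∉ (Set.Icc (-h) h ×ˢ Set.Icc (-h) h : Set (ℝ × ℝ)) →
      W p.1 p.2 = 0 := by
    intro p hp
    apply h0
    by_contra hc
    push Not at hc
    exact hp ⟨abs_le.1 hc.2, abs_le.1 hc.1⟩
  have hmb : MeasurableSet (Set.Icc (-h) h ×ˢ Set.Icc (-h) h : Set (ℝ × ℝ)) :=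
    measurableSet_Icc.prod measurableSet_Icc
  -- generic: c * W integrable
  have hint : ∀ c : ℝ × ℝ → ℝ, Measurable c → (∀ p, |c p| ≤ |p.1 - p.2|) →
      Integrable fun p : ℝ × ℝ => c p * W p.1 p.2 := by
    intro c hc hcb
    refine integrable_of_bdd_supp (2 * h * C) (hc.mul hW) hmb (box_fin _ _ _ _) ?_ ?_
    · intro p
      by_cases hp : p ∈ (Set.Icc (-h) h ×ˢ Set.Icc (-h) h : Set (ℝ × ℝ))
      · rw [abs_mul]
        have : |p.1 - p.2| ≤ 2 * h := by
          obtain ⟨⟨_, _⟩, ⟨_, _⟩⟩ := hp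
          rw [abs_le]; constructor <;> linarith
        exact mul_le_mul ((hcb p).trans this) (hC _ _) (abs_nonneg _) (by linarith)
      · rw [hbox p hp]; simp; positivity
    · intro p hp; rw [hbox p hp]; simp
  -- RHS
  have hR : ∫ z in (-h)..h, ∫ z' in (-h)..h, (z' - z) * W z' z
      = ∫ p : ℝ × ℝ, (p.1 - p.2) * W p.1 p.2 := by
    rw [show (volume : Measure (ℝ × ℝ)) = volume.prod volume from rfl]
    rw [integral_prod_symm _ (hint (fun p => p.1 - p.2) (by fun_prop) (fun p => le_rfl))]
    rw [intervalIntegral.integral_of_le (by linarith), ← integral_Icc_eq_integral_Ioc]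
    rw [setIntegral_eq_integral_of_forall_compl_eq_zero]
    · congr 1; ext z
      rw [intervalIntegral.integral_of_le (by linarith), ← integral_Icc_eq_integral_Ioc]
      rw [setIntegral_eq_integral_of_forall_compl_eq_zero]
      intro z' hz'
      rw [hbox (z', z) (fun hp => hz' hp.1)]; simp
    · intro z hz
      have : ∀ z', W z' z = 0 := fun z' => hbox (z', z) (fun hp => hz hp.2)
      simp [this]
  -- LHS
  have hL : ∫ z in (-h)..h, ∫ s in (0:ℝ)..δ, ∫ z' in Set.Ioi z, W z' (z - s)
      = ∫ p : ℝ × ℝ, max (p.1 - p.2) 0 * W p.1 p.2 := by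
    have hWint : Integrable fun p : ℝ × ℝ => W p.1 p.2 :=
      integrable_of_bdd_supp C hW hmb (box_fin _ _ _ _) (fun p => hC _ _) hbox
    have hset : ∀ z : ℝ, MeasurableSet {p : ℝ × ℝ | p.2 ≤ z ∧ z < p.1} := fun z =>
      (measurableSet_le measurable_snd measurable_const).inter
        (measurableSet_lt measurable_const measurable_fst)
    have h1 : ∀ z ∈ Set.Ioo (-h) h, ∫ s in (0:ℝ)..δ, ∫ z' in Set.Ioi z, W z' (z - s)
        = ∫ p : ℝ × ℝ, {p : ℝ × ℝ | p.2 ≤ z ∧ z < p.1}.indicator (fun p => W p.1 p.2) p := by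
      intro z hz
      rw [intervalIntegral.integral_comp_sub_left (fun a => ∫ z' in Set.Ioi z, W z' a) z]
      rw [show (volume : Measure (ℝ × ℝ)) = volume.prod volume from rfl]
      rw [integral_prod_symm _ (hWint.indicator (hset z))]
      rw [intervalIntegral.integral_of_le (by linarith), ← integral_indicator measurableSet_Ioc]
      congr 1; ext a
      by_cases ha : a ≤ z
      · by_cases ha2 : z - δ < a
        · rw [Set.indicator_of_mem (by simp [ha, ha2]), ← integral_indicator measurableSet_Ioi]
          congr 1; ext z'
          simp [Set.indicator_apply, ha]
        · rw [Set.indicator_of_notMem (by simp [ha2])]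
          have : ∀ z', W z' a = 0 := fun z' => h0 _ _ (Or.inl (by
            rw [lt_abs]; right; linarith [hz.2]))
          simp [Set.indicator_apply, this]
      · rw [Set.indicator_of_notMem (by simp [ha])]
        simp [Set.indicator_apply, ha]
    rw [intervalIntegral.integral_of_le (by linarith), integral_Ioc_eq_integral_Ioo,
      setIntegral_congr_fun measurableSet_Ioo h1, ← integral_Ioc_eq_integral_Ioo,
      ← integral_Icc_eq_integral_Ioc]
    rw [integral_integral_swap]
    · congr 1; ext p
      by_cases hp : p ∈ (Set.Icc (-h) h ×ˢ Set.Icc (-h) h : Set (ℝ × ℝ))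
      · have : ∀ z : ℝ, {p : ℝ × ℝ | p.2 ≤ z ∧ z < p.1}.indicator (fun p => W p.1 p.2) p
            = (Set.Ico p.2 p.1).indicator (fun _ => W p.1 p.2) z := by
          intro z; simp [Set.indicator_apply]
        simp_rw [this]
        rw [setIntegral_indicator measurableSet_Ico, Set.inter_eq_self_of_subset_right]
        · simp [Measure.real, ENNReal.toReal_ofReal']
        · intro z hz
          exact ⟨hp.2.1.trans hz.1, hz.2.le.trans hp.1.2⟩
      · have := hbox p hp
        simp [Set.indicator_apply, this]
    · have hm : MeasurableSet {r : ℝ × (ℝ × ℝ) | r.2.2 ≤ r.1 ∧ r.1 < r.2.1} :=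
        (measurableSet_le (f := fun r : ℝ × (ℝ × ℝ) => r.2.2) (g := fun r => r.1)
            (by fun_prop) (by fun_prop)).inter
          (measurableSet_lt (f := fun r : ℝ × (ℝ × ℝ) => r.1) (g := fun r => r.2.1)
            (by fun_prop) (by fun_prop))
      have hi : Integrable (fun r : ℝ × (ℝ × ℝ) => (1:ℝ) * W r.2.1 r.2.2)
          ((volume.restrict (Set.Icc (-h) h)).prod volume) :=
        Integrable.mul_prod (f := fun _ => (1:ℝ)) (g := fun p : ℝ × ℝ => W p.1 p.2)
          (integrable_const _) hWint
      refine (hi.indicator hm).congr (Filter.Eventually.of_forall fun r => ?_)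
      simp [Set.indicator_apply, Function.uncurry]
  -- symmetry
  have hneg : ∫ p : ℝ × ℝ, max (p.1 - p.2) 0 * W p.1 p.2
      = ∫ p : ℝ × ℝ, -(max (p.2 - p.1) 0 * W p.1 p.2) := by
    rw [← integral_neg_eq_self]
    congr 1; ext p
    simp only [Prod.fst_neg, Prod.snd_neg, hodd]
    ring_nf
  have hi1 : Integrable fun p : ℝ × ℝ => max (p.1 - p.2) 0 * W p.1 p.2 :=
    hint (fun p => max (p.1 - p.2) 0) (by fun_prop) (fun p => by
      rw [abs_of_nonneg (le_max_right _ _)]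
      exact max_le (le_abs_self _) (abs_nonneg _))
  have hi2 : Integrable fun p : ℝ × ℝ => max (p.2 - p.1) 0 * W p.1 p.2 :=
    hint (fun p => max (p.2 - p.1) 0) (by fun_prop) (fun p => by
      rw [abs_of_nonneg (le_max_right _ _), abs_sub_comm]
      exact max_le (le_abs_self _) (abs_nonneg _))
  have hsum : ∫ p : ℝ × ℝ, (p.1 - p.2) * W p.1 p.2
      = (∫ p : ℝ × ℝ, max (p.1 - p.2) 0 * W p.1 p.2)
        + ∫ p : ℝ × ℝ, -(max (p.2 - p.1) 0 * W p.1 p.2) := by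
    rw [← integral_add hi1 hi2.fun_neg]
    congr 1; ext p
    rcases le_total p.1 p.2 with hp | hp
    · rw [max_eq_right (by linarith), max_eq_left (by linarith)]; ring
    · rw [max_eq_left (by linarith), max_eq_right (by linarith)]; ring
  rw [hL, hR, hsum, ← hneg]
  ring

theorem statement16 (h δ : ℝ) (hh : 0 < h) (hδ : 2*h ≤ δ)
    (lam : ℝ → ℝ → ℝ → ℝ → ℝ)
    (hbdd : ∃ M, ∀ ξ₁ ξ₂ z' z, |lam ξ₁ ξ₂ z' z| ≤ M)
    (hmeas : Measurable fun p : ℝ × ℝ × ℝ × ℝ => lam p.1 p.2.1 p.2.2.1 p.2.2.2)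
    (hsym1 : ∀ ξ₁ ξ₂ z' z, lam ξ₁ ξ₂ z' z = lam ξ₁ ξ₂ (-z') (-z))
    (hsym2 : ∀ ξ₁ ξ₂ z' z, lam ξ₁ ξ₂ z' z = lam ξ₁ ξ₂ z z')
    (hvanish : ∀ ξ₁ ξ₂ z' z, (h < |z| ∨ h < |z'| ∨ δ^2 ≤ ξ₁^2 + ξ₂^2 + (z'-z)^2) →
      lam ξ₁ ξ₂ z' z = 0)
    (u : ℝ → ℝ → ℝ → Fin 3 → ℝ)
    (hubdd : ∃ M, ∀ x y z i, |u x y z i| ≤ M)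
    (hucont : Continuous fun p : ℝ × ℝ × ℝ =>
      (fun i => u p.1 p.2.1 p.2.2 i : Fin 3 → ℝ))
    (hpar : ∀ x y z, u x y (-z) 0 = u x y z 0 ∧ u x y (-z) 1 = u x y z 1 ∧
      u x y (-z) 2 = -(u x y z 2)) :
    ∀ x y : ℝ,
      (1/(2*h)) * ∫ z in (-h)..h, tau3 δ lam u x y z
        = (1/(4*h)) * ∫ z in (-h)..h, ∫ z' in (-h)..h, ∫ q : ℝ × ℝ,
            lam q.1 q.2 z' z * (z' - z)^2 *
              (q.1 * (u (x + q.1) (y + q.2) z' 0 - u x y z 0)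
                + q.2 * (u (x + q.1) (y + q.2) z' 1 - u x y z 1)
                + (z' - z) * (u (x + q.1) (y + q.2) z' 2 - u x y z 2)) := by
  intro x y
  obtain ⟨M, hM⟩ := hbdd
  obtain ⟨N, hN⟩ := hubdd
  have hM0 : 0 ≤ M := (abs_nonneg _).trans (hM 0 0 0 0)
  have hN0 : 0 ≤ N := (abs_nonneg _).trans (hN 0 0 0 0)
  have hδ0 : 0 < δ := by linarith
  have hum : ∀ i, Measurable fun p : ℝ × ℝ × ℝ => u p.1 p.2.1 p.2.2 i := fun i =>
    ((continuous_pi_iff.1 hucont) i).measurable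
  -- the integrand
  set F : ℝ × ℝ → ℝ → ℝ → ℝ := fun q z' a => lam q.1 q.2 z' a *
      (q.1 * (u (x + q.1) (y + q.2) z' 0 - u x y a 0)
        + q.2 * (u (x + q.1) (y + q.2) z' 1 - u x y a 1)
        + (z' - a) * (u (x + q.1) (y + q.2) z' 2 - u x y a 2)) with hF
  have hFm : Measurable fun r : (ℝ × ℝ) × (ℝ × ℝ) => F r.2 r.1.1 r.1.2 := by
    have e1 : Measurable fun r : (ℝ × ℝ) × (ℝ × ℝ) => lam r.2.1 r.2.2 r.1.1 r.1.2 :=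
      hmeas.comp (g := fun p : ℝ × ℝ × ℝ × ℝ => lam p.1 p.2.1 p.2.2.1 p.2.2.2)
        (f := fun r : (ℝ × ℝ) × (ℝ × ℝ) => (r.2.1, r.2.2, r.1.1, r.1.2)) (by fun_prop)
    have e2 : ∀ i, Measurable fun r : (ℝ × ℝ) × (ℝ × ℝ) => u (x + r.2.1) (y + r.2.2) r.1.1 i :=
      fun i => (hum i).comp (f := fun r : (ℝ × ℝ) × (ℝ × ℝ) => (x + r.2.1, y + r.2.2, r.1.1))
        (by fun_prop)
    have e3 : ∀ i, Measurable fun r : (ℝ × ℝ) × (ℝ × ℝ) => u x y r.1.2 i :=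
      fun i => (hum i).comp (f := fun r : (ℝ × ℝ) × (ℝ × ℝ) => (x, y, r.1.2)) (by fun_prop)
    have f0 := e2 0
    have f1 := e2 1
    have f2 := e2 2
    have g0 := e3 0
    have g1 := e3 1
    have g2 := e3 2
    simp only [hF]
    fun_prop
  have hFbox : ∀ q z' a, F q z' a ≠ 0 →
      |q.1| ≤ δ ∧ |q.2| ≤ δ ∧ |z'| ≤ h ∧ |a| ≤ h ∧ |z' - a| ≤ δ := by
    intro q z' a hne
    have hl : lam q.1 q.2 z' a ≠ 0 := fun h0 => hne (by simp [hF, h0])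
    have := mt (hvanish q.1 q.2 z' a) hl
    push Not at this
    obtain ⟨c1, c2, c3⟩ := this
    refine ⟨abs_le_of_sq_le_sq ?_ hδ0.le, abs_le_of_sq_le_sq ?_ hδ0.le, c2, c1,
      abs_le_of_sq_le_sq ?_ hδ0.le⟩
    · nlinarith [sq_nonneg q.1, sq_nonneg q.2, sq_nonneg (z' - a)]
    · nlinarith [sq_nonneg q.1, sq_nonneg q.2, sq_nonneg (z' - a)]
    · nlinarith [sq_nonneg q.1, sq_nonneg q.2, sq_nonneg (z' - a)]
  set B : ℝ := M * (3 * (δ * (2 * N))) with hB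
  have hB0 : 0 ≤ B := by positivity
  have hFb : ∀ q z' a, |F q z' a| ≤ B := by
    intro q z' a
    by_cases hne : F q z' a = 0
    · rw [hne]; simpa using hB0
    obtain ⟨c1, c2, _, _, c3⟩ := hFbox q z' a hne
    have hd : ∀ i, |u (x + q.1) (y + q.2) z' i - u x y a i| ≤ 2 * N := by
      intro i
      refine (abs_sub _ _).trans ?_
      linarith [hN (x + q.1) (y + q.2) z' i, hN x y a i]
    have hp : ∀ t i, |t| ≤ δ → |t * (u (x + q.1) (y + q.2) z' i - u x y a i)| ≤ δ * (2 * N) := by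
      intro t i ht
      rw [abs_mul]
      exact mul_le_mul ht (hd i) (abs_nonneg _) hδ0.le
    simp only [hF]
    rw [abs_mul]
    refine mul_le_mul (hM _ _ _ _) ?_ (abs_nonneg _) hM0
    refine (abs_add_three _ _ _).trans ?_
    linarith [hp _ 0 c1, hp _ 1 c2, hp _ 2 c3]
  set K : ℝ → ℝ → ℝ := fun z' a => ∫ q : ℝ × ℝ, F q z' a with hK
  have hKm : Measurable fun p : ℝ × ℝ => K p.1 p.2 :=
    (hFm.stronglyMeasurable.integral_prod_right' (ν := (volume : Measure (ℝ × ℝ)))).measurable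
  have hK0 : ∀ z' a, (h < |a| ∨ h < |z'|) → K z' a = 0 := by
    intro z' a hza
    have : ∀ q, F q z' a = 0 := by
      intro q
      by_contra hne
      obtain ⟨_, _, c1, c2, _⟩ := hFbox q z' a hne
      rcases hza with hza | hza <;> linarith
    simp [hK, this]
  set V : ℝ := volume.real (Set.Icc (-δ) δ ×ˢ Set.Icc (-δ) δ : Set (ℝ × ℝ)) with hV
  have hKb : ∀ z' a, |K z' a| ≤ B * V := by
    intro z' a
    have : K z' a = ∫ q in (Set.Icc (-δ) δ ×ˢ Set.Icc (-δ) δ : Set (ℝ × ℝ)), F q z' a := by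
      rw [setIntegral_eq_integral_of_forall_compl_eq_zero]
      intro q hq
      by_contra hne
      obtain ⟨c1, c2, _⟩ := hFbox q z' a hne
      exact hq ⟨abs_le.1 c1, abs_le.1 c2⟩
    rw [this]
    exact norm_setIntegral_le_of_norm_le_const (f := fun q => F q z' a) (C := B)
      (box_fin _ _ _ _) (fun q _ => hFb q z' a)
  have hKe : ∀ z' a, K (-z') (-a) = K z' a := by
    intro z' a
    simp only [hK, hF]
    congr 1; ext q
    rw [← hsym1, (hpar _ _ z').1, (hpar _ _ z').2.1, (hpar _ _ z').2.2,
      (hpar _ _ a).1, (hpar _ _ a).2.1, (hpar _ _ a).2.2]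
    ring
  have hV0 : 0 ≤ V := measureReal_nonneg
  have key := lemA h δ hh hδ (fun z' a => (z' - a) * K z' a) (2 * h * (B * V))
    ((measurable_fst.sub measurable_snd).mul hKm) (by
      intro z' a
      by_cases hc : h < |a| ∨ h < |z'|
      · rw [hK0 _ _ hc]; simp; positivity
      · push Not at hc
        rw [abs_mul]
        refine mul_le_mul ?_ (hKb _ _) (abs_nonneg _) (by linarith)
        refine (abs_sub _ _).trans ?_
        linarith) (by
      intro z' a hc; simp only [hK0 _ _ hc, mul_zero]) (by
      intro z' a; simp only [hKe]; ring)
  -- the inner integral in tau3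
  have hin : ∀ z, tau3 δ lam u x y z
      = ∫ s in (0:ℝ)..δ, ∫ z' in Set.Ioi z, (z' - (z - s)) * K z' (z - s) := by
    intro z
    unfold tau3
    congr 1; ext s
    generalize z - s = a
    have hS : MeasurableSet {p : ℝ × ℝ × ℝ |
        (p.1 - x)^2 + (p.2.1 - y)^2 + (p.2.2 - a)^2 < δ^2 ∧ z < p.2.2} :=
      (measurableSet_lt
        (f := fun p : ℝ × ℝ × ℝ => (p.1 - x)^2 + (p.2.1 - y)^2 + (p.2.2 - a)^2)
        (g := fun _ => δ^2) (by fun_prop) (by fun_prop)).inter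
        (measurableSet_lt (f := fun _ : ℝ × ℝ × ℝ => z) (g := fun p => p.2.2)
          (by fun_prop) (by fun_prop))
    rw [← integral_indicator hS]
    set g : (ℝ × ℝ) × ℝ → ℝ := fun r =>
      {r : (ℝ × ℝ) × ℝ | z < r.2}.indicator
        (fun r => (r.2 - a) * F (r.1 - (x, y)) r.2 a) r with hg
    have hgm : Measurable g := by
      refine Measurable.indicator ?_ (measurableSet_lt (by fun_prop) (by fun_prop))
      refine (measurable_snd.sub_const a).mul ?_
      exact hFm.comp (f := fun r : (ℝ × ℝ) × ℝ => ((r.2, a), r.1 - (x, y))) (by fun_prop)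
    have hgi : Integrable g := by
      refine integrable_of_bdd_supp (δ * B)
        (s := (Set.Icc (x - δ) (x + δ) ×ˢ Set.Icc (y - δ) (y + δ)) ×ˢ Set.Icc (-h) h) hgm
        ((measurableSet_Icc.prod measurableSet_Icc).prod measurableSet_Icc)
        ((isCompact_Icc.prod isCompact_Icc).prod isCompact_Icc).measure_lt_top ?_ ?_
      · intro r
        simp only [hg, Set.indicator_apply]
        split_ifs
        · by_cases hne : F (r.1 - (x, y)) r.2 a = 0
          · rw [hne]; simp; positivity
          · rw [abs_mul]
            exact mul_le_mul (hFbox _ _ _ hne).2.2.2.2 (hFb _ _ _) (abs_nonneg _) hδ0.le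
        · simp; positivity
      · intro r hr
        have : F (r.1 - (x, y)) r.2 a = 0 := by
          by_contra hne
          obtain ⟨c1, c2, c3, _⟩ := hFbox _ _ _ hne
          simp only [Prod.fst_sub, Prod.snd_sub] at c1 c2
          rw [abs_le] at c1 c2 c3
          exact hr ⟨⟨⟨by linarith, by linarith⟩, ⟨by linarith, by linarith⟩⟩, c3⟩
        simp [hg, Set.indicator_apply, this]
    have e1 : ∀ p : ℝ × ℝ × ℝ, {p : ℝ × ℝ × ℝ |
        (p.1 - x)^2 + (p.2.1 - y)^2 + (p.2.2 - a)^2 < δ^2 ∧ z < p.2.2}.indicator (fun p =>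
          lam (p.1 - x) (p.2.1 - y) p.2.2 a * (p.2.2 - a) *
          (∑ j, (![p.1 - x, p.2.1 - y, p.2.2 - a] j) *
          (u p.1 p.2.1 p.2.2 j - u x y a j))) p = g ((p.1, p.2.1), p.2.2) := by
      intro p
      simp only [hg, hF, Set.indicator_apply, Set.mem_ofPred_eq, Prod.fst_sub, Prod.snd_sub,
        Fin.sum_univ_three, Matrix.cons_val]
      rw [add_sub_cancel x p.1, add_sub_cancel y p.2.1]
      by_cases hz : z < p.2.2
      · by_cases hb : (p.1 - x)^2 + (p.2.1 - y)^2 + (p.2.2 - a)^2 < δ^2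
        · simp only [hz, hb, and_self, if_true]; ring
        · rw [hvanish _ _ _ _ (Or.inr (Or.inr (not_lt.1 hb)))]
          simp
      · simp [hz]
    simp_rw [e1]
    have e2 : ∫ p : ℝ × ℝ × ℝ, g ((p.1, p.2.1), p.2.2) = ∫ r : (ℝ × ℝ) × ℝ, g r := by
      rw [← (volume_preserving_prodAssoc (α₁ := ℝ) (β₁ := ℝ) (γ₁ := ℝ)).integral_comp'
        (g := fun p : ℝ × ℝ × ℝ => g ((p.1, p.2.1), p.2.2))]
      rfl
    rw [e2, show (volume : Measure ((ℝ × ℝ) × ℝ)) = volume.prod volume from rfl,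
      integral_prod_symm _ hgi, ← integral_indicator measurableSet_Ioi]
    congr 1; ext z'
    by_cases hz : z < z'
    · simp only [hg, Set.indicator_apply, Set.mem_ofPred_eq, Set.mem_Ioi, hz, if_true]
      rw [integral_const_mul,
        integral_sub_right_eq_self (fun q => F q z' a) (x, y)]
    · simp [hg, hz]
  simp_rw [hin]
  rw [key]
  have e3 : ∀ z' z, ∫ q : ℝ × ℝ, lam q.1 q.2 z' z * (z' - z)^2 *
              (q.1 * (u (x + q.1) (y + q.2) z' 0 - u x y z 0)
                + q.2 * (u (x + q.1) (y + q.2) z' 1 - u x y z 1)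
                + (z' - z) * (u (x + q.1) (y + q.2) z' 2 - u x y z 2))
      = (z' - z) * ((z' - z) * K z' z) := by
    intro z' z
    rw [hK, ← integral_const_mul, ← integral_const_mul]
    congr 1; ext q
    simp only [hF]; ring
  simp_rw [e3]
  field_simp
  ring
end
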